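/- Let D be a finite distributive lattice and let α₀, α₁, α₂ be three pairwise incomparable join-irreducible elements of D (a three-element antichain in J(D)), and set α = α₀ ⊔ α₁ ⊔ α₂. Then the subset Q = J⁺(D) ∪ {α} is not principal congruence representable. -/

import Mathlib

/-- A congruence of a lattice: an equivalence relation compatible with `⊔` and `⊓`. -/
structure LatCon (L : Type*) [Lattice L] where
  r : L → L → Prop
  refl : ∀ a, r a a
  symm : ∀ {a b}, r a b → r b a
  trans : ∀ {a b c}, r a b → r b c → r a c
  sup_comp : ∀ {a b c d}, r a b → r c d → r (a ⊔ c) (b ⊔ d)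
  inf_comp : ∀ {a b c d}, r a b → r c d → r (a ⊓ c) (b ⊓ d)

namespace LatCon

variable {L : Type*} [Lattice L]

theorem ext' {θ ψ : LatCon L} (h : ∀ a b, θ.r a b ↔ ψ.r a b) : θ = ψ := by
  cases θ; cases ψ
  simp only [mk.injEq]
  funext a b
  exact propext (h a b)

/-- Congruences are ordered by containment. -/
instance : PartialOrder (LatCon L) where
  le θ ψ := ∀ a b, θ.r a b → ψ.r a b
  le_refl θ := fun _ _ h => h
  le_trans θ ψ χ h1 h2 := fun a b h => h2 a b (h1 a b h)
  le_antisymm θ ψ h1 h2 := ext' fun a b => ⟨h1 a b, h2 a b⟩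

instance : InfSet (LatCon L) where
  sInf S :=
    { r := fun a b => ∀ θ ∈ S, θ.r a b
      refl := fun a θ _ => θ.refl a
      symm := fun h θ hθ => θ.symm (h θ hθ)
      trans := fun h1 h2 θ hθ => θ.trans (h1 θ hθ) (h2 θ hθ)
      sup_comp := fun h1 h2 θ hθ => θ.sup_comp (h1 θ hθ) (h2 θ hθ)
      inf_comp := fun h1 h2 θ hθ => θ.inf_comp (h1 θ hθ) (h2 θ hθ) }

/-- `Con L`, the lattice of congruences of `L`, is a complete lattice. -/
instance : CompleteLattice (LatCon L) :=
  completeLatticeOfInf (LatCon L) fun S =>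
    ⟨fun θ hθ a b h => h θ hθ, fun ψ hψ a b h θ hθ => hψ hθ a b h⟩

/-- The principal congruence `con(a, b)`: the smallest congruence collapsing `a` and `b`. -/
def princ (a b : L) : LatCon L := sInf {θ : LatCon L | θ.r a b}

/-- A congruence is principal if it is of the form `con(a, b)`. -/
def IsPrincipal (θ : LatCon L) : Prop := ∃ a b : L, θ = princ a b

end LatCon

/-- `Princ L`, the set of principal congruences of a lattice `L`,
ordered by containment (the order inherited from `Con L`). -/
def Princ (L : Type*) [Lattice L] : Set (LatCon L) := {θ : LatCon L | θ.IsPrincipal}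

/-- `J⁺(D) = {⊥, ⊤} ∪ J(D)`, where `J(D)` is the set of join-irreducible elements. -/
def Jplus (D : Type*) [Lattice D] [BoundedOrder D] : Set D :=
  {⊥, ⊤} ∪ {x : D | SupIrred x}

/-- `Q ⊆ D` is principal congruence representable: there are a finite lattice `L` and
an order isomorphism `φ : Con L ≃o D` mapping `Princ L` exactly onto `Q`. -/
def Representable (D : Type*) [Lattice D] (Q : Set D) : Prop :=
  ∃ (L : Type) (_ : Lattice L) (_ : Fintype L) (φ : LatCon L ≃o D),
    φ '' Princ L = Q

/-- `D` is fully representable: every candidate `J⁺(D) ⊆ Q ⊆ D` is representable. -/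
def FullyRepresentable (D : Type*) [Lattice D] [BoundedOrder D] : Prop :=
  ∀ Q : Set D, Jplus D ⊆ Q → Representable D Q

universe u


namespace LatCon

variable {L : Type*} [Lattice L]

theorem princ_rel (x y : L) : (princ x y).r x y := fun _ hθ => hθ

theorem princ_le_iff {x y : L} {θ : LatCon L} : princ x y ≤ θ ↔ θ.r x y :=
  ⟨fun h => h x y (princ_rel x y), fun h _ _ hab => hab θ h⟩

/-- The union of a nonempty family of congruences is a congruence as soon as it is transitive. -/
def ofUnion {ι : Type*} [Nonempty ι] (θ : ι → LatCon L)
    (htrans : ∀ {x y z : L}, (∃ i, (θ i).r x y) → (∃ i, (θ i).r y z) → ∃ i, (θ i).r x z) :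
    LatCon L where
  r x y := ∃ i, (θ i).r x y
  refl x := ⟨Classical.arbitrary ι, (θ _).refl x⟩
  symm := fun ⟨i, h⟩ => ⟨i, (θ i).symm h⟩
  trans := htrans
  sup_comp := fun ⟨i, h⟩ ⟨j, h'⟩ =>
    htrans ⟨i, (θ i).sup_comp h ((θ i).refl _)⟩ ⟨j, (θ j).sup_comp ((θ j).refl _) h'⟩
  inf_comp := fun ⟨i, h⟩ ⟨j, h'⟩ =>
    htrans ⟨i, (θ i).inf_comp h ((θ i).refl _)⟩ ⟨j, (θ j).inf_comp ((θ j).refl _) h'⟩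

/-- If every principal congruence below a join of two members of a nonempty family lies below
a member of the family, then so does every principal congruence below the join of the family. -/
theorem exists_princ_le_of_le_iSup {ι : Type*} [Nonempty ι] (θ : ι → LatCon L)
    (h : ∀ i j (x y : L), princ x y ≤ θ i ⊔ θ j → ∃ k, princ x y ≤ θ k)
    {x y : L} (hxy : princ x y ≤ ⨆ i, θ i) : ∃ i, princ x y ≤ θ i := by
  have htrans : ∀ {x y z : L}, (∃ i, (θ i).r x y) → (∃ i, (θ i).r y z) →
      ∃ i, (θ i).r x z := by
    rintro x y z ⟨i, hi⟩ ⟨j, hj⟩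
    obtain ⟨k, hk⟩ := h i j x z <| princ_le_iff.2 <| (θ i ⊔ θ j).trans
      ((le_sup_left : θ i ≤ θ i ⊔ θ j) _ _ hi) ((le_sup_right : θ j ≤ θ i ⊔ θ j) _ _ hj)
    exact ⟨k, princ_le_iff.1 hk⟩
  have hle : ⨆ i, θ i ≤ ofUnion θ htrans := iSup_le fun i _ _ hi => ⟨i, hi⟩
  obtain ⟨i, hi⟩ := princ_le_iff.1 (hxy.trans hle)
  exact ⟨i, princ_le_iff.2 hi⟩

end LatCon

/-- An element of `J⁺(D) ∪ {c}` below `a ⊔ b` lies below `a` or below `b`, provided that `c` is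
above a join-irreducible element that is neither below `a` nor below `b`. -/
theorem le_or_le_of_mem_Jplus_union {D : Type*} [DistribLattice D] [BoundedOrder D]
    {a b c d p : D} (hd : SupIrred d) (hda : ¬ d ≤ a) (hdb : ¬ d ≤ b) (hdc : d ≤ c)
    (hp : p ∈ Jplus D ∪ {c}) (hpab : p ≤ a ⊔ b) : p ≤ a ∨ p ≤ b := by
  have hdp : ¬ d ≤ p := fun h => (hd.supPrime.2 (h.trans hpab)).elim hda hdb
  rcases hp with (hp | hp) | hp
  · rcases hp with rfl | rfl
    · exact Or.inl bot_le
    · exact absurd le_top hdp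
  · exact (SupIrred.supPrime hp).2 hpab
  · exact absurd (hdc.trans (Set.mem_singleton_iff.1 hp).ge) hdp

/-- **(Key step of Theorem 14.)** If `α₀, α₁, α₂` is a three-element antichain of
join-irreducible elements of a finite distributive lattice `D` and
`α = α₀ ⊔ α₁ ⊔ α₂`, then `Q = J⁺(D) ∪ {α}` is not representable. -/
theorem Jplus_union_join_of_antichain_not_representable
    (D : Type*) [DistribLattice D] [Fintype D] [BoundedOrder D]
    (a0 a1 a2 : D) (h0 : SupIrred a0) (h1 : SupIrred a1) (h2 : SupIrred a2)
    (h01 : ¬ a0 ≤ a1) (h10 : ¬ a1 ≤ a0)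
    (h02 : ¬ a0 ≤ a2) (h20 : ¬ a2 ≤ a0)
    (h12 : ¬ a1 ≤ a2) (h21 : ¬ a2 ≤ a1) :
    ¬ Representable D (Jplus D ∪ {a0 ⊔ a1 ⊔ a2}) := by
  rintro ⟨L, _, _, φ, hφ⟩
  let a : Fin 3 → D := ![a0, a1, a2]
  have hirr : ∀ i, SupIrred (a i) := by
    intro i; fin_cases i <;> assumption
  have hanti : ∀ i j, i ≠ j → ¬ a i ≤ a j := by
    intro i j hij
    fin_cases i <;> fin_cases j <;> first | exact absurd rfl hij | assumption
  have hle : ∀ i, a i ≤ a0 ⊔ a1 ⊔ a2 := by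
    intro i
    fin_cases i
    · exact le_sup_left.trans le_sup_left
    · exact le_sup_right.trans le_sup_left
    · exact le_sup_right
  have hthird : ∀ i j : Fin 3, ∃ k, k ≠ i ∧ k ≠ j := by decide
  obtain ⟨_, ⟨x, y, rfl⟩, hxy⟩ : a0 ⊔ a1 ⊔ a2 ∈ φ '' Princ L := hφ ▸ Or.inr rfl
  have key : ∃ i, LatCon.princ x y ≤ φ.symm (a i) := by
    refine LatCon.exists_princ_le_of_le_iSup (fun i => φ.symm (a i)) (fun i j u v huv => ?_) ?_
    · obtain ⟨k, hki, hkj⟩ := hthird i j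
      have hmem : φ (LatCon.princ u v) ∈ Jplus D ∪ {a0 ⊔ a1 ⊔ a2} :=
        hφ ▸ Set.mem_image_of_mem φ ⟨u, v, rfl⟩
      have huv' : φ (LatCon.princ u v) ≤ a i ⊔ a j := by
        rwa [← map_sup, φ.le_symm_apply] at huv
      rcases le_or_le_of_mem_Jplus_union (hirr k) (hanti k i hki) (hanti k j hkj) (hle k)
        hmem huv' with h | h
      exacts [⟨i, φ.le_symm_apply.2 h⟩, ⟨j, φ.le_symm_apply.2 h⟩]
    · have hi : ∀ i, a i ≤ φ (⨆ i, φ.symm (a i)) := fun i =>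
        φ.symm_apply_le.1 (le_iSup (fun i => φ.symm (a i)) i)
      rw [← φ.le_iff_le, hxy]
      exact sup_le (sup_le (hi 0) (hi 1)) (hi 2)
  obtain ⟨i, hi⟩ := key
  rw [φ.le_symm_apply, hxy] at hi
  obtain ⟨k, hki, -⟩ := hthird i i
  exact hanti k i hki ((hle k).trans hi)
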